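/- arXiv:solv-int/9710022 — 3 statements merged into one kernel-verified Lean document; each statement's English description precedes it below -/
import Mathlib

section
/- Let ε ∈ ℝ with 0 < ε < 1, L := log(1/ε) with L ≥ 1, B > 0 real, κ := 6 + 2πB with κ·ε^{5/7}·L² ≤ 1, and α ∈ ℂ with |α| ≥ 1/ε. Let d ∈ ℂ with d³ = −1/2, and R_d(v) := (v − d)²·(v² + 2dv + 3d²). Let U ⊆ ℂ be open, w analytic on U with w″(z) = 2·w(z)³ + 1 + (z/α)·w(z) on U, and γ : [0,1] → U a C¹ path of length at most 2πB with |γ(t)| ≤ 3ε·|α|, |w(γ(t))| ≤ L and |R_d(w(γ(t)))| ≥ ε^{1/7} for all t. Suppose δ ∈ ℂ satisfies (w′(γ(0))² − w(γ(0))⁴ − 2·w(γ(0)))/2 = −(3/4)·d + δ² with |δ| ≤ ε^{1/7}, and let p : [0,1] → ℂ be continuous with p(t)² = R_d(w(γ(t))) and |w′(γ(t)) + p(t)| ≥ |p(t)| for all t. Then: (i) |w′(γ(1))² − R_d(w(γ(1)))| ≤ 3·ε^{2/7}, and (ii) |∫₀¹ (w′(γ(t))/p(t))·γ′(t) dt −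 (γ(1) − γ(0))| ≤ 6π·B·ε^{1/7}. -/
open Set

/-- A weighted integral of `f` is at most the sup bound of `f` times the integral of the weight. -/
theorem norm_integral_mul_le_of_norm_le {f g : ℝ → ℂ} {C ℓ T : ℝ} (hT : T ∈ Icc (0 : ℝ) 1)
    (hC : 0 ≤ C) (hf : ∀ t ∈ Icc (0 : ℝ) 1, ‖f t‖ ≤ C) (hg : ContinuousOn g (Icc (0 : ℝ) 1))
    (hℓ : (∫ t in (0 : ℝ)..1, ‖g t‖) ≤ ℓ) :
    ‖∫ t in (0 : ℝ)..T, f t * g t‖ ≤ C * ℓ := by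
  have hi : IntervalIntegrable (fun t => ‖g t‖) MeasureTheory.volume 0 1 :=
    hg.norm.intervalIntegrable_of_Icc zero_le_one
  have hi' : IntervalIntegrable (fun t => ‖g t‖) MeasureTheory.volume 0 T :=
    (hg.norm.mono (Icc_subset_Icc_right hT.2)).intervalIntegrable_of_Icc hT.1
  have h1 : ‖∫ t in (0 : ℝ)..T, f t * g t‖ ≤ ∫ t in (0 : ℝ)..T, C * ‖g t‖ := by
    refine intervalIntegral.norm_integral_le_of_norm_le hT.1 (.of_forall fun t ht => ?_)
      (hi'.const_mul C)
    rw [norm_mul]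
    exact mul_le_mul_of_nonneg_right (hf t ⟨ht.1.le, ht.2.trans hT.2⟩) (norm_nonneg _)
  have h2 : (∫ t in (0 : ℝ)..T, ‖g t‖) ≤ ∫ t in (0 : ℝ)..1, ‖g t‖ :=
    intervalIntegral.integral_mono_interval le_rfl hT.1 hT.2
      (.of_forall fun t => norm_nonneg _) hi
  rw [intervalIntegral.integral_const_mul] at h1
  exact h1.trans (mul_le_mul_of_nonneg_left (h2.trans hℓ) hC)

/-- The energy identity for the scaled second Painlevé equation, integrated by parts
along a path. -/
theorem painleveII_energy_sub_eq {α : ℂ} {U : Set ℂ} {w : ℂ → ℂ}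
    (hw : ∀ z ∈ U, AnalyticAt ℂ w z)
    (hweq : ∀ z ∈ U, deriv (deriv w) z = 2 * w z ^ 3 + 1 + (z / α) * w z)
    {γ γ' : ℝ → ℂ} (hγU : ∀ t ∈ Icc (0 : ℝ) 1, γ t ∈ U)
    (hγd : ∀ t ∈ Icc (0 : ℝ) 1, HasDerivWithinAt γ (γ' t) (Icc (0 : ℝ) 1) t)
    (hγ'c : ContinuousOn γ' (Icc (0 : ℝ) 1)) {T : ℝ} (hT : T ∈ Icc (0 : ℝ) 1) :
    (deriv w (γ T) ^ 2 - w (γ T) ^ 4 - 2 * w (γ T)) -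
        (deriv w (γ 0) ^ 2 - w (γ 0) ^ 4 - 2 * w (γ 0)) =
      γ T / α * w (γ T) ^ 2 - γ 0 / α * w (γ 0) ^ 2 -
        ∫ t in (0 : ℝ)..T, (w (γ t) ^ 2 / α) * γ' t := by
  have hsub : Icc (0 : ℝ) T ⊆ Icc 0 1 := Icc_subset_Icc_right hT.2
  have hwγ (t) (ht : t ∈ Icc (0 : ℝ) 1) :
      HasDerivWithinAt (fun t => w (γ t)) (deriv w (γ t) * γ' t) (Icc 0 1) t :=
    (hw _ (hγU t ht)).differentiableAt.hasDerivAt.comp_hasDerivWithinAt t (hγd t ht)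
  have hw'γ (t) (ht : t ∈ Icc (0 : ℝ) 1) :
      HasDerivWithinAt (fun t => deriv w (γ t)) (deriv (deriv w) (γ t) * γ' t) (Icc 0 1) t :=
    (hw _ (hγU t ht)).deriv.differentiableAt.hasDerivAt.comp_hasDerivWithinAt t (hγd t ht)
  have hG (t) (ht : t ∈ Icc (0 : ℝ) 1) : HasDerivWithinAt
      (fun t => γ t / α * w (γ t) ^ 2 - (deriv w (γ t) ^ 2 - w (γ t) ^ 4 - 2 * w (γ t)))
      ((w (γ t) ^ 2 / α) * γ' t) (Icc 0 1) t := by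
    refine ((((hγd t ht).div_const α).mul ((hwγ t ht).pow 2)).sub
      ((((hw'γ t ht).pow 2).sub ((hwγ t ht).pow 4)).sub ((hwγ t ht).const_mul 2))).congr_deriv ?_
    rw [hweq _ (hγU t ht)]
    simp only [Pi.pow_apply]
    push_cast
    ring
  have hcont : ContinuousOn (fun t => w (γ t) ^ 2 / α * γ' t) (Icc 0 1) :=
    (((show ContinuousOn (fun t => w (γ t)) (Icc 0 1) from
      fun t ht => (hwγ t ht).continuousWithinAt).pow 2).div_const α).mul hγ'c
  rw [intervalIntegral.integral_eq_sub_of_hasDerivAt_of_le hT.1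
    (fun t ht => ((hG t (hsub ht)).mono hsub).continuousWithinAt)
    (fun t ht => (hG t ⟨ht.1.le, ht.2.le.trans hT.2⟩).hasDerivAt
      (Icc_mem_nhds ht.1 (ht.2.trans_le hT.2)))
    ((hcont.mono hsub).intervalIntegrable_of_Icc hT.1)]
  ring

/-- Theorem 3.1 (nearly degenerate solutions): for a solution of
`w″ = 2w³ + 1 + (z/α)w` whose energy is `E = −(3/4)d + δ²` with `|δ| ≤ ε^{1/7}`
(`d³ = −1/2`), along a path where `|R_d(w)| ≥ ε^{1/7}` one has
`|w′² − R_d(w)| ≤ 3ε^{2/7}` and the singly periodic integral estimate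
`|∫₀¹ (w′/p)·γ′ dt − (γ(1) − γ(0))| ≤ 6πB·ε^{1/7}`. -/
theorem painleveII_nearly_degenerate_estimates
    (ε L B κ : ℝ) (hε0 : 0 < ε) (hε1 : ε < 1)
    (hL : L = Real.log (1 / ε)) (hL1 : 1 ≤ L)
    (hB : 0 < B) (hκ : κ = 6 + 2 * Real.pi * B)
    (hκε : κ * ε ^ ((5 : ℝ) / 7) * L ^ 2 ≤ 1)
    (α : ℂ) (hα : 1 / ε ≤ ‖α‖)
    (d : ℂ) (hd : d ^ 3 = -(1 / 2))
    (R : ℂ → ℂ) (hR : ∀ v : ℂ, R v = (v - d) ^ 2 * (v ^ 2 + 2 * d * v + 3 * d ^ 2))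
    (U : Set ℂ) (hU : IsOpen U)
    (w : ℂ → ℂ) (hw : ∀ z ∈ U, AnalyticAt ℂ w z)
    (hweq : ∀ z ∈ U, deriv (deriv w) z = 2 * w z ^ 3 + 1 + (z / α) * w z)
    (γ γ' : ℝ → ℂ)
    (hγU : ∀ t ∈ Icc (0 : ℝ) 1, γ t ∈ U)
    (hγd : ∀ t ∈ Icc (0 : ℝ) 1, HasDerivWithinAt γ (γ' t) (Icc (0 : ℝ) 1) t)
    (hγ'c : ContinuousOn γ' (Icc (0 : ℝ) 1))
    (hlen : (∫ t in (0 : ℝ)..1, ‖γ' t‖) ≤ 2 * Real.pi * B)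
    (hγb : ∀ t ∈ Icc (0 : ℝ) 1, ‖γ t‖ ≤ 3 * ε * ‖α‖)
    (hwb : ∀ t ∈ Icc (0 : ℝ) 1, ‖w (γ t)‖ ≤ L)
    (hRb : ∀ t ∈ Icc (0 : ℝ) 1, ε ^ ((1 : ℝ) / 7) ≤ ‖R (w (γ t))‖)
    (δ : ℂ)
    (hδ : (deriv w (γ 0) ^ 2 - w (γ 0) ^ 4 - 2 * w (γ 0)) / 2 = -(3 / 4) * d + δ ^ 2)
    (hδb : ‖δ‖ ≤ ε ^ ((1 : ℝ) / 7))
    (p : ℝ → ℂ) (hpc : ContinuousOn p (Icc (0 : ℝ) 1))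
    (hp2 : ∀ t ∈ Icc (0 : ℝ) 1, p t ^ 2 = R (w (γ t)))
    (hbranch : ∀ t ∈ Icc (0 : ℝ) 1, ‖p t‖ ≤ ‖deriv w (γ t) + p t‖) :
    ‖deriv w (γ 1) ^ 2 - R (w (γ 1))‖ ≤ 3 * ε ^ ((2 : ℝ) / 7) ∧
    ‖(∫ t in (0 : ℝ)..1, (deriv w (γ t) / p t) * γ' t) - (γ 1 - γ 0)‖
      ≤ 6 * Real.pi * B * ε ^ ((1 : ℝ) / 7) := by
  have hα0 : 0 < ‖α‖ := lt_of_lt_of_le (by positivity) hα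
  have hαinv : ‖α‖⁻¹ ≤ ε := by
    rw [inv_le_comm₀ hα0 hε0, ← one_div]
    exact hα
  have hL0 : 0 ≤ L := zero_le_one.trans hL1
  have hRe (v : ℂ) : R v = v ^ 4 + 2 * v - 3 / 2 * d := by
    rw [hR]
    linear_combination (-4 * v + 3 * d) * hd
  have hw2 (t) (ht : t ∈ Icc (0 : ℝ) 1) : ‖w (γ t)‖ ^ 2 ≤ L ^ 2 :=
    pow_le_pow_left₀ (norm_nonneg _) (hwb t ht) 2
  have hbdry (t) (ht : t ∈ Icc (0 : ℝ) 1) : ‖γ t / α * w (γ t) ^ 2‖ ≤ 3 * ε * L ^ 2 := by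
    rw [norm_mul, norm_div, norm_pow]
    gcongr
    · exact (div_le_iff₀ hα0).2 (hγb t ht)
    · exact hwb t ht
  have hsmall : 6 * ε * L ^ 2 + ε * L ^ 2 * (2 * Real.pi * B) ≤ ε ^ ((2 : ℝ) / 7) := by
    have h : ε ^ ((2 : ℝ) / 7) * ε ^ ((5 : ℝ) / 7) = ε := by
      rw [← Real.rpow_add hε0]
      norm_num
    calc _ = ε ^ ((2 : ℝ) / 7) * ε ^ ((5 : ℝ) / 7) * (κ * L ^ 2) := by rw [h, hκ]; ring
      _ = ε ^ ((2 : ℝ) / 7) * (κ * ε ^ ((5 : ℝ) / 7) * L ^ 2) := by ring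
      _ ≤ ε ^ ((2 : ℝ) / 7) := mul_le_of_le_one_right (by positivity) hκε
  have hsq : (ε ^ ((1 : ℝ) / 7)) ^ 2 = ε ^ ((2 : ℝ) / 7) := by
    rw [← Real.rpow_natCast, ← Real.rpow_mul hε0.le]
    norm_num
  have hD (T) (hT : T ∈ Icc (0 : ℝ) 1) :
      ‖deriv w (γ T) ^ 2 - R (w (γ T))‖ ≤ 3 * ε ^ ((2 : ℝ) / 7) := by
    have hint : ‖∫ t in (0 : ℝ)..T, (w (γ t) ^ 2 / α) * γ' t‖ ≤
        ε * L ^ 2 * (2 * Real.pi * B) := by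
      refine norm_integral_mul_le_of_norm_le hT (by positivity) (fun t ht => ?_) hγ'c hlen
      rw [norm_div, norm_pow, div_eq_mul_inv, mul_comm]
      exact mul_le_mul hαinv (hw2 t ht) (by positivity) hε0.le
    have hδ2 : ‖2 * δ ^ 2‖ ≤ 2 * ε ^ ((2 : ℝ) / 7) := by
      rw [norm_mul, norm_pow, ← hsq, Complex.norm_two]
      gcongr
    have heq : deriv w (γ T) ^ 2 - R (w (γ T)) = 2 * δ ^ 2 + (γ T / α * w (γ T) ^ 2 -
        γ 0 / α * w (γ 0) ^ 2 - ∫ t in (0 : ℝ)..T, (w (γ t) ^ 2 / α) * γ' t) := by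
      rw [← painleveII_energy_sub_eq hw hweq hγU hγd hγ'c hT, hRe]
      linear_combination 2 * hδ
    rw [heq]
    have h1 := norm_add_le (2 * δ ^ 2) (γ T / α * w (γ T) ^ 2 -
        γ 0 / α * w (γ 0) ^ 2 - ∫ t in (0 : ℝ)..T, (w (γ t) ^ 2 / α) * γ' t)
    have h2 := norm_sub_le (γ T / α * w (γ T) ^ 2 - γ 0 / α * w (γ 0) ^ 2)
      (∫ t in (0 : ℝ)..T, (w (γ t) ^ 2 / α) * γ' t)
    have h3 := norm_sub_le (γ T / α * w (γ T) ^ 2) (γ 0 / α * w (γ 0) ^ 2)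
    linarith [hbdry T hT, hbdry 0 (left_mem_Icc.2 zero_le_one)]
  refine ⟨hD 1 (right_mem_Icc.2 zero_le_one), ?_⟩
  have hε7 : 0 < ε ^ ((1 : ℝ) / 7) := Real.rpow_pos_of_pos hε0 _
  have hpn (t) (ht : t ∈ Icc (0 : ℝ) 1) : ε ^ ((1 : ℝ) / 7) ≤ ‖p t‖ ^ 2 := by
    rw [← norm_pow, hp2 t ht]
    exact hRb t ht
  have hp0 (t) (ht : t ∈ Icc (0 : ℝ) 1) : p t ≠ 0 := fun h => by
    have := hpn t ht
    rw [h, norm_zero] at this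
    linarith
  have hratio (t) (ht : t ∈ Icc (0 : ℝ) 1) :
      ‖deriv w (γ t) / p t - 1‖ ≤ 3 * ε ^ ((1 : ℝ) / 7) := by
    have hpp : 0 < ‖p t‖ := norm_pos_iff.2 (hp0 t ht)
    have hprod : ‖deriv w (γ t) - p t‖ * ‖deriv w (γ t) + p t‖ ≤ 3 * ε ^ ((2 : ℝ) / 7) := by
      rw [← norm_mul]
      convert hD t ht using 2
      rw [← hp2 t ht]
      ring
    have hle : ‖deriv w (γ t) - p t‖ * ‖p t‖ ≤ 3 * ε ^ ((1 : ℝ) / 7) * ‖p t‖ ^ 2 :=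
      calc _ ≤ ‖deriv w (γ t) - p t‖ * ‖deriv w (γ t) + p t‖ :=
            mul_le_mul_of_nonneg_left (hbranch t ht) (norm_nonneg _)
        _ ≤ 3 * ε ^ ((1 : ℝ) / 7) * ε ^ ((1 : ℝ) / 7) := by rw [← hsq] at hprod; linarith
        _ ≤ _ := mul_le_mul_of_nonneg_left (hpn t ht) (by positivity)
    rw [div_sub_one (hp0 t ht), norm_div, div_le_iff₀ hpp]
    refine le_of_mul_le_mul_right ?_ hpp
    linarith
  have hγc : ContinuousOn γ (Icc 0 1) := fun t ht => (hγd t ht).continuousWithinAt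
  have hw'c : ContinuousOn (fun t => deriv w (γ t)) (Icc 0 1) := fun t ht =>
    (hw _ (hγU t ht)).deriv.continuousAt.comp_continuousWithinAt (hγc t ht)
  have hγi : IntervalIntegrable γ' MeasureTheory.volume 0 1 :=
    hγ'c.intervalIntegrable_of_Icc zero_le_one
  have hqi : IntervalIntegrable (fun t => deriv w (γ t) / p t * γ' t) MeasureTheory.volume 0 1 :=
    ((hw'c.div hpc hp0).mul hγ'c).intervalIntegrable_of_Icc zero_le_one
  rw [← intervalIntegral.integral_eq_sub_of_hasDerivAt_of_le zero_le_one hγc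
    (fun t ht => (hγd t (Ioo_subset_Icc_self ht)).hasDerivAt (Icc_mem_nhds ht.1 ht.2)) hγi,
    ← intervalIntegral.integral_sub hqi hγi]
  have := norm_integral_mul_le_of_norm_le (right_mem_Icc.2 zero_le_one) (by positivity)
    hratio hγ'c hlen
  simp only [sub_one_mul] at this
  linarith
end

section
/- Let ε ∈ ℝ with 0 < ε < 1, L := log(1/ε) with L ≥ 1, B > 0 real, κ := 6 + 2πB, and α ∈ ℂ with |α| ≥ 1/ε. Let d ∈ ℂ with d³ = −1/2 and R_d(v) := (v − d)²·(v² + 2dv + 3d²). Let U ⊆ ℂ be open, w analytic on U with w″(z) = 2·w(z)³ + 1 + (z/α)·w(z) on U, and γ : [0,1] → U a C¹ path of length at most 2πB with |γ(t)| ≤ 3ε·|α|, |w(γ(t))| ≤ L and |R_d(w(γ(t)))| ≥ ε^{1/7} for all t. Suppose δ ∈ ℂ satisfies (w′(γ(0))² − w(γ(0))⁴ − 2·w(γ(0)))/2 = −(3/4)·d + δ² with |δ| ≤ ε², and let p : [0,1] → ℂ be continuous with p(t)² = R_d(w(γ(t))) and |w′(γ(t)) + p(t)| ≥ |p(t)|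 for all t. Then: (i) |w′(γ(1))² − R_d(w(γ(1)))| ≤ (κ + 2)·ε·L², and (ii) |∫₀¹ (w′(γ(t))/p(t))·γ′(t) dt − (γ(1) − γ(0))| ≤ 2π·(κ + 2)·B·ε^{6/7}·L². -/
open Set

/-- A path whose velocity is controlled by that of `γ` moves by at most the length of `γ`,
up to the same factor. -/
theorem norm_sub_le_mul_integral_norm {f f' γ' : ℝ → ℂ} {C : ℝ}
    (hf : ∀ t ∈ Icc (0 : ℝ) 1, HasDerivWithinAt f (f' t) (Icc (0 : ℝ) 1) t)
    (hf' : ContinuousOn f' (Icc (0 : ℝ) 1)) (hγ' : ContinuousOn γ' (Icc (0 : ℝ) 1))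
    (hC : 0 ≤ C) (hle : ∀ t ∈ Icc (0 : ℝ) 1, ‖f' t‖ ≤ C * ‖γ' t‖)
    {t : ℝ} (ht : t ∈ Icc (0 : ℝ) 1) :
    ‖f t - f 0‖ ≤ C * ∫ s in (0 : ℝ)..1, ‖γ' s‖ := by
  have hsub : Icc (0 : ℝ) t ⊆ Icc 0 1 := Icc_subset_Icc_right ht.2
  have hint : IntervalIntegrable (fun s => ‖γ' s‖) MeasureTheory.volume 0 1 :=
    hγ'.norm.intervalIntegrable_of_Icc zero_le_one
  have hint' : IntervalIntegrable (fun s => ‖γ' s‖) MeasureTheory.volume 0 t :=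
    (hγ'.norm.mono hsub).intervalIntegrable_of_Icc ht.1
  have hftc : ∫ s in (0 : ℝ)..t, f' s = f t - f 0 := by
    refine intervalIntegral.integral_eq_sub_of_hasDerivAt_of_le ht.1
      (fun s hs => (hf s (hsub hs)).continuousWithinAt.mono hsub) (fun s hs => ?_)
      ((hf'.mono hsub).intervalIntegrable_of_Icc ht.1)
    exact (hf s (hsub (Ioo_subset_Icc_self hs))).hasDerivAt
      (Icc_mem_nhds hs.1 (hs.2.trans_le ht.2))
  rw [← hftc]
  calc ‖∫ s in (0 : ℝ)..t, f' s‖ ≤ ∫ s in (0 : ℝ)..t, C * ‖γ' s‖ :=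
        intervalIntegral.norm_integral_le_of_norm_le ht.1
          (Filter.Eventually.of_forall fun s hs => hle s (hsub (Ioc_subset_Icc_self hs)))
          (hint'.const_mul C)
    _ = C * ∫ s in (0 : ℝ)..t, ‖γ' s‖ := intervalIntegral.integral_const_mul _ _
    _ ≤ C * ∫ s in (0 : ℝ)..1, ‖γ' s‖ := by
        refine mul_le_mul_of_nonneg_left ?_ hC
        exact intervalIntegral.integral_mono_interval le_rfl ht.1 ht.2
          (Filter.Eventually.of_forall fun s => norm_nonneg _) hint

/-- If `p ^ 2` is close to `u ^ 2`, then `u / p` is close to `1`, provided `p` is the square root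
for which `u + p` does not cancel. -/
theorem norm_div_sub_one_le {u p : ℂ} (hp : p ≠ 0) (h : ‖p‖ ≤ ‖u + p‖) :
    ‖u / p - 1‖ ≤ ‖u ^ 2 - p ^ 2‖ / ‖p ^ 2‖ := by
  have hp' : 0 < ‖p‖ := norm_pos_iff.2 hp
  have key : (u / p - 1) * p = u - p := by field_simp
  rw [le_div_iff₀ (by rw [norm_pow]; positivity), norm_pow, sq, ← mul_assoc, ← norm_mul, key,
    show u ^ 2 - p ^ 2 = (u - p) * (u + p) by ring, norm_mul]
  exact mul_le_mul_of_nonneg_left h (norm_nonneg _)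

/-- Theorem 3.2 (almost degenerate solutions): for a solution of
`w″ = 2w³ + 1 + (z/α)w` whose energy is `E = −(3/4)d + δ²` with `|δ| ≤ ε²`
(`d³ = −1/2`), along a path where `|R_d(w)| ≥ ε^{1/7}` one has
`|w′² − R_d(w)| ≤ (κ + 2)εL²` and
`|∫₀¹ (w′/p)·γ′ dt − (γ(1) − γ(0))| ≤ 2π(κ + 2)B·ε^{6/7}·L²`. -/
theorem painleveII_almost_degenerate_estimates
    (ε L B κ : ℝ) (hε0 : 0 < ε) (hε1 : ε < 1)
    (hL : L = Real.log (1 / ε)) (hL1 : 1 ≤ L)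
    (hB : 0 < B) (hκ : κ = 6 + 2 * Real.pi * B)
    (α : ℂ) (hα : 1 / ε ≤ ‖α‖)
    (d : ℂ) (hd : d ^ 3 = -(1 / 2))
    (R : ℂ → ℂ) (hR : ∀ v : ℂ, R v = (v - d) ^ 2 * (v ^ 2 + 2 * d * v + 3 * d ^ 2))
    (U : Set ℂ) (hU : IsOpen U)
    (w : ℂ → ℂ) (hw : ∀ z ∈ U, AnalyticAt ℂ w z)
    (hweq : ∀ z ∈ U, deriv (deriv w) z = 2 * w z ^ 3 + 1 + (z / α) * w z)
    (γ γ' : ℝ → ℂ)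
    (hγU : ∀ t ∈ Icc (0 : ℝ) 1, γ t ∈ U)
    (hγd : ∀ t ∈ Icc (0 : ℝ) 1, HasDerivWithinAt γ (γ' t) (Icc (0 : ℝ) 1) t)
    (hγ'c : ContinuousOn γ' (Icc (0 : ℝ) 1))
    (hlen : (∫ t in (0 : ℝ)..1, ‖γ' t‖) ≤ 2 * Real.pi * B)
    (hγb : ∀ t ∈ Icc (0 : ℝ) 1, ‖γ t‖ ≤ 3 * ε * ‖α‖)
    (hwb : ∀ t ∈ Icc (0 : ℝ) 1, ‖w (γ t)‖ ≤ L)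
    (hRb : ∀ t ∈ Icc (0 : ℝ) 1, ε ^ ((1 : ℝ) / 7) ≤ ‖R (w (γ t))‖)
    (δ : ℂ)
    (hδ : (deriv w (γ 0) ^ 2 - w (γ 0) ^ 4 - 2 * w (γ 0)) / 2 = -(3 / 4) * d + δ ^ 2)
    (hδb : ‖δ‖ ≤ ε ^ 2)
    (p : ℝ → ℂ) (hpc : ContinuousOn p (Icc (0 : ℝ) 1))
    (hp2 : ∀ t ∈ Icc (0 : ℝ) 1, p t ^ 2 = R (w (γ t)))
    (hbranch : ∀ t ∈ Icc (0 : ℝ) 1, ‖p t‖ ≤ ‖deriv w (γ t) + p t‖) :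
    ‖deriv w (γ 1) ^ 2 - R (w (γ 1))‖ ≤ (κ + 2) * ε * L ^ 2 ∧
    ‖(∫ t in (0 : ℝ)..1, (deriv w (γ t) / p t) * γ' t) - (γ 1 - γ 0)‖
      ≤ 2 * Real.pi * (κ + 2) * B * ε ^ ((6 : ℝ) / 7) * L ^ 2 := by
  have hLnn : 0 ≤ L := zero_le_one.trans hL1
  have hπ := Real.pi_pos
  have hαpos : 0 < ‖α‖ := (one_div_pos.2 hε0).trans_le hα
  have hαinv : 1 / ‖α‖ ≤ ε := by
    rw [div_le_iff₀ hαpos]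
    rwa [div_le_iff₀ hε0, mul_comm] at hα
  have hκ0 : 0 ≤ κ + 2 := by rw [hκ]; positivity
  have hRexp : ∀ v : ℂ, R v = v ^ 4 + 2 * v - 3 / 2 * d := fun v => by
    rw [hR]; linear_combination (3 * d - 4 * v) * hd
  have hwd : ∀ z ∈ U, HasDerivAt w (deriv w z) z := fun z hz =>
    (hw z hz).differentiableAt.hasDerivAt
  have hwd2 : ∀ z ∈ U, HasDerivAt (deriv w) (2 * w z ^ 3 + 1 + (z / α) * w z) z := fun z hz =>
    hweq z hz ▸ (hw z hz).deriv.differentiableAt.hasDerivAt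
  have hγc : ContinuousOn γ (Icc 0 1) := fun t ht => (hγd t ht).continuousWithinAt
  have hwc : ContinuousOn (fun t => w (γ t)) (Icc 0 1) := fun t ht =>
    (hwd _ (hγU t ht)).continuousAt.comp_continuousWithinAt (hγc t ht)
  have hw'c : ContinuousOn (fun t => deriv w (γ t)) (Icc 0 1) := fun t ht =>
    (hwd2 _ (hγU t ht)).continuousAt.comp_continuousWithinAt (hγc t ht)
  have h0 : (0 : ℝ) ∈ Icc (0 : ℝ) 1 := by simp
  have h1 : (1 : ℝ) ∈ Icc (0 : ℝ) 1 := by simp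
  let G : ℂ → ℂ := fun z => deriv w z ^ 2 - (w z ^ 4 + 2 * w z) - z / α * w z ^ 2
  have hG : ∀ z ∈ U, HasDerivAt G (-(w z ^ 2 / α)) z := fun z hz => by
    have h := (((hwd2 z hz).pow 2).sub (((hwd z hz).pow 4).add ((hwd z hz).const_mul 2))).sub
      (((hasDerivAt_id z).div_const α).mul ((hwd z hz).pow 2))
    refine h.congr_deriv ?_
    simp only [id, Pi.pow_apply]
    push_cast
    ring
  have hGle : ∀ t ∈ Icc (0 : ℝ) 1, ‖G (γ t) - G (γ 0)‖ ≤ ε * L ^ 2 * (2 * Real.pi * B) := by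
    intro t ht
    refine (norm_sub_le_mul_integral_norm (f := fun s => G (γ s))
      (f' := fun s => -(w (γ s) ^ 2 / α) * γ' s) (C := ε * L ^ 2)
      (fun s hs => (hG _ (hγU s hs)).comp_hasDerivWithinAt s (hγd s hs))
      (((hwc.pow 2).div_const α).neg.mul hγ'c) hγ'c (by positivity) (fun s hs => ?_) ht).trans
      (mul_le_mul_of_nonneg_left hlen (by positivity))
    rw [norm_mul, norm_neg, norm_div, norm_pow, div_eq_mul_one_div, mul_comm (‖w (γ s)‖ ^ 2)]
    have := hwb s hs
    gcongr
  have hbdry : ∀ t ∈ Icc (0 : ℝ) 1, ‖γ t / α * w (γ t) ^ 2‖ ≤ 3 * ε * L ^ 2 := by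
    intro t ht
    rw [norm_mul, norm_div, norm_pow]
    have hb := hwb t ht
    have hd' : ‖γ t‖ / ‖α‖ ≤ 3 * ε := (div_le_iff₀ hαpos).2 (hγb t ht)
    gcongr
  have hδ2 : ‖2 * δ ^ 2‖ ≤ 2 * ε * L ^ 2 := by
    rw [norm_mul, norm_pow, Complex.norm_ofNat]
    have hε2 : ‖δ‖ ^ 2 ≤ ε := calc
      ‖δ‖ ^ 2 ≤ (ε ^ 2) ^ 2 := by gcongr
      _ = ε ^ 4 := by ring
      _ ≤ ε := pow_le_of_le_one hε0.le hε1.le (by norm_num)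
    nlinarith [one_le_pow₀ hL1 (n := 2)]
  have hF : ∀ t ∈ Icc (0 : ℝ) 1,
      ‖deriv w (γ t) ^ 2 - R (w (γ t))‖ ≤ (κ + 2) * ε * L ^ 2 := by
    intro t ht
    have hsplit : deriv w (γ t) ^ 2 - R (w (γ t)) = 2 * δ ^ 2 + γ t / α * w (γ t) ^ 2
        - γ 0 / α * w (γ 0) ^ 2 + (G (γ t) - G (γ 0)) := by
      simp only [G]
      rw [hRexp]
      linear_combination 2 * hδ
    rw [hsplit]
    have e1 := norm_add_le (2 * δ ^ 2 + γ t / α * w (γ t) ^ 2 - γ 0 / α * w (γ 0) ^ 2)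
      (G (γ t) - G (γ 0))
    have e2 := norm_sub_le (2 * δ ^ 2 + γ t / α * w (γ t) ^ 2) (γ 0 / α * w (γ 0) ^ 2)
    have e3 := norm_add_le (2 * δ ^ 2) (γ t / α * w (γ t) ^ 2)
    have e4 := hbdry t ht
    have e5 := hbdry 0 h0
    have e6 := hGle t ht
    rw [hκ]
    linarith
  refine ⟨hF 1 h1, ?_⟩
  have hp0 : ∀ t ∈ Icc (0 : ℝ) 1, p t ≠ 0 := fun t ht h => by
    have hpos := (Real.rpow_pos_of_pos hε0 ((1 : ℝ) / 7)).trans_le (hRb t ht)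
    simp [← hp2 t ht, h] at hpos
  have hγint : ∫ t in (0 : ℝ)..1, γ' t = γ 1 - γ 0 :=
    intervalIntegral.integral_eq_sub_of_hasDerivAt_of_le zero_le_one hγc
      (fun t ht => (hγd t (Ioo_subset_Icc_self ht)).hasDerivAt (Icc_mem_nhds ht.1 ht.2))
      (hγ'c.intervalIntegrable_of_Icc zero_le_one)
  have hquot : ContinuousOn (fun t => deriv w (γ t) / p t * γ' t) (Icc 0 1) :=
    (hw'c.div hpc hp0).mul hγ'c
  rw [← hγint, ← intervalIntegral.integral_sub
    (hquot.intervalIntegrable_of_Icc zero_le_one)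
    (hγ'c.intervalIntegrable_of_Icc zero_le_one)]
  have hεpow : ε / ε ^ ((1 : ℝ) / 7) = ε ^ ((6 : ℝ) / 7) := by
    rw [show (6 : ℝ) / 7 = 1 - 1 / 7 by norm_num, Real.rpow_sub hε0, Real.rpow_one]
  have hpt : ∀ t ∈ Icc (0 : ℝ) 1, ‖deriv w (γ t) / p t * γ' t - γ' t‖
      ≤ (κ + 2) * ε ^ ((6 : ℝ) / 7) * L ^ 2 * ‖γ' t‖ := by
    intro t ht
    rw [show deriv w (γ t) / p t * γ' t - γ' t = (deriv w (γ t) / p t - 1) * γ' t by ring,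
      norm_mul]
    refine mul_le_mul_of_nonneg_right ?_ (norm_nonneg _)
    have h := norm_div_sub_one_le (hp0 t ht) (hbranch t ht)
    rw [hp2 t ht] at h
    calc _ ≤ _ := h
      _ ≤ (κ + 2) * ε * L ^ 2 / ε ^ ((1 : ℝ) / 7) :=
          div_le_div₀ (by positivity) (hF t ht) (Real.rpow_pos_of_pos hε0 _) (hRb t ht)
      _ = _ := by rw [← hεpow]; ring
  calc _ ≤ ∫ t in (0 : ℝ)..1, (κ + 2) * ε ^ ((6 : ℝ) / 7) * L ^ 2 * ‖γ' t‖ :=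
        intervalIntegral.norm_integral_le_of_norm_le zero_le_one
          (Filter.Eventually.of_forall fun t ht => hpt t (Ioc_subset_Icc_self ht))
          ((hγ'c.norm.intervalIntegrable_of_Icc zero_le_one).const_mul _)
    _ = (κ + 2) * ε ^ ((6 : ℝ) / 7) * L ^ 2 * ∫ t in (0 : ℝ)..1, ‖γ' t‖ :=
        intervalIntegral.integral_const_mul _ _
    _ ≤ (κ + 2) * ε ^ ((6 : ℝ) / 7) * L ^ 2 * (2 * Real.pi * B) :=
        mul_le_mul_of_nonneg_left hlen (by positivity)
    _ = _ := by ring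
end

section
/- Let ε ∈ ℝ with 0 < ε < 1, L := log(1/ε) with L ≥ 1, B > 0 real, κ := 6 + 2πB with κ·ε^{5/7}·L² ≤ 1, and α ∈ ℂ with |α| ≥ 1/ε. Let d ∈ ℂ with d³ = −1/2, and suppose ε^{1/7} < |d|² and 6|d|² + 4|d|·ε^{1/14} + ε^{1/7} < 7|d|². Let U ⊆ ℂ be open, w analytic on U with w″(z) = 2·w(z)³ + 1 + (z/α)·w(z) on U, and γ : [0,1] → U a C¹ path of length at most 2πB such that for all t ∈ [0,1]: |γ(t)| ≤ 3ε·|α|, ε^{1/7} ≤ |w(γ(t))| and |w(γ(t)) − d| ≤ ε^{1/14}. Assume the degenerate initial bounds |w′(γ(0))| ≤ ε^{1/7} and |w(γ(0)) − d| ≤ ε^{1/14}. Then |w′(γ(1))² − 6d²·(w(γ(1)) − d)²| ≤ 14·|d|²·ε^{1/7}. -/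
open Set

/-- Along a path `γ`, a solution of `w″ = 2w³ + 1 + (z/α)w` has modified energy
`w′² - w⁴ - 2w - (z/α)w²` with derivative `-(w²/α)γ′`. -/
lemma hasDerivWithinAt_painleveII_energy {α : ℂ} {w : ℂ → ℂ} {γ : ℝ → ℂ} {v : ℂ} {s : Set ℝ} {t : ℝ}
    (hw : AnalyticAt ℂ w (γ t))
    (hweq : deriv (deriv w) (γ t) = 2 * w (γ t) ^ 3 + 1 + (γ t / α) * w (γ t))
    (hγ : HasDerivWithinAt γ v s t) :
    HasDerivWithinAt
      (fun x ↦ deriv w (γ x) ^ 2 - w (γ x) ^ 4 - 2 * w (γ x) - γ x / α * w (γ x) ^ 2)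
      (-(w (γ t) ^ 2 / α * v)) s t := by
  have h1 : HasDerivWithinAt (fun x ↦ w (γ x)) (deriv w (γ t) * v) s t :=
    hw.differentiableAt.hasDerivAt.comp_hasDerivWithinAt t hγ
  have h2 : HasDerivWithinAt (fun x ↦ deriv w (γ x)) (deriv (deriv w) (γ t) * v) s t :=
    hw.deriv.differentiableAt.hasDerivAt.comp_hasDerivWithinAt t hγ
  refine ((((h2.fun_pow 2).sub (h1.fun_pow 4)).sub (h1.const_mul 2)).sub
    ((hγ.div_const α).mul (h1.fun_pow 2))).congr_deriv ?_
  rw [hweq]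
  push_cast
  ring

/-- The modified energy varies along a path by at most `M² / |α|` times the length of the path
when `|w| ≤ M` on it. -/
lemma norm_painleveII_energy_sub_le {α : ℂ} {w : ℂ → ℂ} {γ γ' : ℝ → ℂ} {M : ℝ}
    (hw : ∀ t ∈ Icc (0 : ℝ) 1, AnalyticAt ℂ w (γ t))
    (hweq : ∀ t ∈ Icc (0 : ℝ) 1,
      deriv (deriv w) (γ t) = 2 * w (γ t) ^ 3 + 1 + (γ t / α) * w (γ t))
    (hγd : ∀ t ∈ Icc (0 : ℝ) 1, HasDerivWithinAt γ (γ' t) (Icc (0 : ℝ) 1) t)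
    (hγ'c : ContinuousOn γ' (Icc (0 : ℝ) 1))
    (hM : ∀ t ∈ Icc (0 : ℝ) 1, ‖w (γ t)‖ ≤ M) :
    ‖(deriv w (γ 1) ^ 2 - w (γ 1) ^ 4 - 2 * w (γ 1) - γ 1 / α * w (γ 1) ^ 2) -
      (deriv w (γ 0) ^ 2 - w (γ 0) ^ 4 - 2 * w (γ 0) - γ 0 / α * w (γ 0) ^ 2)‖
      ≤ M ^ 2 / ‖α‖ * ∫ t in (0 : ℝ)..1, ‖γ' t‖ := by
  have hd := fun t ht ↦ hasDerivWithinAt_painleveII_energy (hw t ht) (hweq t ht) (hγd t ht)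
  have hwc : ContinuousOn (fun t ↦ w (γ t)) (Icc (0 : ℝ) 1) := fun t ht ↦
    (hw t ht).continuousAt.comp_continuousWithinAt (hγd t ht).continuousWithinAt
  have hint : IntervalIntegrable (fun t ↦ -(w (γ t) ^ 2 / α * γ' t)) MeasureTheory.volume 0 1 := by
    apply ContinuousOn.intervalIntegrable_of_Icc zero_le_one
    exact (((hwc.pow 2).div_const α).mul hγ'c).neg
  rw [← intervalIntegral.integral_eq_sub_of_hasDerivAt_of_le zero_le_one
    (fun t ht ↦ (hd t ht).continuousWithinAt)
    (fun t ht ↦ (hd t (Ioo_subset_Icc_self ht)).hasDerivAt (Icc_mem_nhds ht.1 ht.2)) hint,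
    ← intervalIntegral.integral_const_mul]
  refine intervalIntegral.norm_integral_le_of_norm_le zero_le_one
    (.of_forall fun t ht ↦ ?_)
    ((hγ'c.norm.intervalIntegrable_of_Icc zero_le_one).const_mul _)
  rw [norm_neg, norm_mul, norm_div, norm_pow]
  gcongr
  exact hM t (Ioc_subset_Icc_self ht)

/-- Numerical form of the estimate, in terms of `δ = ε^{1/14}` and `D = |d|`. -/
lemma degenerate_error_le {δ D : ℝ} (hδ : 0 ≤ δ) (hD : 0 ≤ D) (hD1 : D ≤ 1)
    (hlo : δ ^ 2 < D ^ 2) (hsum : 6 * D ^ 2 + 4 * D * δ + δ ^ 2 < 7 * D ^ 2) :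
    (4 * D * δ ^ 3 + δ ^ 4) + (δ ^ 2) ^ 2 + (6 * D ^ 2 * δ ^ 2 + 4 * D * δ ^ 3 + δ ^ 4)
      + (δ ^ 2) ^ 2 * (D + δ) ^ 2 ≤ 14 * D ^ 2 * δ ^ 2 := by
  have hδD : δ ≤ D := (lt_of_pow_lt_pow_left₀ 2 hD hlo).le
  have h4 : (D + δ) ^ 2 ≤ 2 ^ 2 := by gcongr; linarith
  have h : (4 * D * δ + δ ^ 2) + δ ^ 2 + (6 * D ^ 2 + 4 * D * δ + δ ^ 2)
      + δ ^ 2 * (D + δ) ^ 2 ≤ 14 * D ^ 2 := by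
    nlinarith [mul_le_mul_of_nonneg_left h4 (sq_nonneg δ)]
  nlinarith [mul_le_mul_of_nonneg_right h (sq_nonneg δ)]

/-- First estimate of Theorem 3.4 (degenerate solutions): a
solution of `w″ = 2w³ + 1 + (z/α)w` that starts with degenerate initial values
(`|w′(γ(0))| ≤ ε^{1/7}`, `|w(γ(0)) − d| ≤ ε^{1/14}`) and stays within
`ε^{1/14}` of the double root `d` satisfies the linearized energy relation
`|w′² − 6d²(w − d)²| ≤ 14|d|²·ε^{1/7}`. -/
theorem painleveII_degenerate_first_estimate
    (ε L B κ : ℝ) (hε0 : 0 < ε) (hε1 : ε < 1)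
    (hL : L = Real.log (1 / ε)) (hL1 : 1 ≤ L)
    (hB : 0 < B) (hκ : κ = 6 + 2 * Real.pi * B)
    (hκε : κ * ε ^ ((5 : ℝ) / 7) * L ^ 2 ≤ 1)
    (α : ℂ) (hα : 1 / ε ≤ ‖α‖)
    (d : ℂ) (hd : d ^ 3 = -(1 / 2))
    (hdlo : ε ^ ((1 : ℝ) / 7) < ‖d‖ ^ 2)
    (hdsum : 6 * ‖d‖ ^ 2 + 4 * ‖d‖ * ε ^ ((1 : ℝ) / 14) + ε ^ ((1 : ℝ) / 7)
      < 7 * ‖d‖ ^ 2)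
    (U : Set ℂ) (hU : IsOpen U)
    (w : ℂ → ℂ) (hw : ∀ z ∈ U, AnalyticAt ℂ w z)
    (hweq : ∀ z ∈ U, deriv (deriv w) z = 2 * w z ^ 3 + 1 + (z / α) * w z)
    (γ γ' : ℝ → ℂ)
    (hγU : ∀ t ∈ Icc (0 : ℝ) 1, γ t ∈ U)
    (hγd : ∀ t ∈ Icc (0 : ℝ) 1, HasDerivWithinAt γ (γ' t) (Icc (0 : ℝ) 1) t)
    (hγ'c : ContinuousOn γ' (Icc (0 : ℝ) 1))
    (hlen : (∫ t in (0 : ℝ)..1, ‖γ' t‖) ≤ 2 * Real.pi * B)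
    (hγb : ∀ t ∈ Icc (0 : ℝ) 1, ‖γ t‖ ≤ 3 * ε * ‖α‖)
    (hwlo : ∀ t ∈ Icc (0 : ℝ) 1, ε ^ ((1 : ℝ) / 7) ≤ ‖w (γ t)‖)
    (hwd : ∀ t ∈ Icc (0 : ℝ) 1, ‖w (γ t) - d‖ ≤ ε ^ ((1 : ℝ) / 14))
    (hη' : ‖deriv w (γ 0)‖ ≤ ε ^ ((1 : ℝ) / 7))
    (hηd : ‖w (γ 0) - d‖ ≤ ε ^ ((1 : ℝ) / 14)) :
    ‖deriv w (γ 1) ^ 2 - 6 * d ^ 2 * (w (γ 1) - d) ^ 2‖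
      ≤ 14 * ‖d‖ ^ 2 * ε ^ ((1 : ℝ) / 7) := by
  have hs : ε ^ ((1 : ℝ) / 7) = (ε ^ ((1 : ℝ) / 14)) ^ 2 := by
    rw [← Real.rpow_natCast, ← Real.rpow_mul hε0.le]; norm_num
  have hsmall : κ * ε ≤ ((ε ^ ((1 : ℝ) / 14)) ^ 2) ^ 2 := by
    have h57 : ε = ε ^ ((5 : ℝ) / 7) * ((ε ^ ((1 : ℝ) / 14)) ^ 2) ^ 2 := by
      rw [← hs, ← Real.rpow_natCast, ← Real.rpow_mul hε0.le, ← Real.rpow_add hε0]; norm_num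
    have hκ0 : 0 ≤ κ * ε ^ ((5 : ℝ) / 7) := by rw [hκ]; positivity
    have h1 : κ * ε ^ ((5 : ℝ) / 7) ≤ 1 :=
      (le_mul_of_one_le_right hκ0 (one_le_pow₀ hL1)).trans hκε
    calc κ * ε = κ * ε ^ ((5 : ℝ) / 7) * ((ε ^ ((1 : ℝ) / 14)) ^ 2) ^ 2 := by
          rw [mul_assoc, ← h57]
      _ ≤ 1 * ((ε ^ ((1 : ℝ) / 14)) ^ 2) ^ 2 := by gcongr
      _ = _ := one_mul _
  have hδ0 : 0 ≤ ε ^ ((1 : ℝ) / 14) := by positivity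
  rw [hs] at hdlo hdsum hη' ⊢
  generalize ε ^ ((1 : ℝ) / 14) = δ at *
  have hαpos : 0 < ‖α‖ := (one_div_pos.2 hε0).trans_le hα
  have hd1 : ‖d‖ ≤ 1 := by
    have : ‖d‖ ^ 3 = 1 / 2 := by rw [← norm_pow, hd]; norm_num
    exact (pow_le_one_iff_of_nonneg (norm_nonneg d) three_ne_zero).1 (by linarith)
  have hM : ∀ t ∈ Icc (0 : ℝ) 1, ‖w (γ t)‖ ≤ ‖d‖ + δ := fun t ht ↦ by
    linarith [norm_sub_norm_le (w (γ t)) d, hwd t ht]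
  have hR := norm_painleveII_energy_sub_le (fun t ht ↦ hw _ (hγU t ht))
    (fun t ht ↦ hweq _ (hγU t ht)) hγd hγ'c hM
  have hbdry : ∀ t ∈ Icc (0 : ℝ) 1, ‖γ t / α * w (γ t) ^ 2‖ ≤ 3 * ε * (‖d‖ + δ) ^ 2 :=
    fun t ht ↦ by
      rw [norm_mul, norm_div, norm_pow]
      gcongr
      · exact (div_le_iff₀ hαpos).2 (hγb t ht)
      · exact hM t ht
  have hlen' : (‖d‖ + δ) ^ 2 / ‖α‖ * (∫ t in (0 : ℝ)..1, ‖γ' t‖)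
      ≤ (‖d‖ + δ) ^ 2 * ε * (2 * Real.pi * B) := by
    rw [div_eq_mul_inv]
    gcongr
    · exact intervalIntegral.integral_nonneg zero_le_one fun t _ ↦ norm_nonneg _
    · simpa using inv_anti₀ (one_div_pos.2 hε0) hα
  have h0 : (0 : ℝ) ∈ Icc (0 : ℝ) 1 := left_mem_Icc.2 zero_le_one
  have h1 : (1 : ℝ) ∈ Icc (0 : ℝ) 1 := right_mem_Icc.2 zero_le_one
  have hb0 := hbdry 0 h0
  have hb1 := hbdry 1 h1
  have hu1 := hwd 1 h1
  have hκR : ε * κ * (‖d‖ + δ) ^ 2 ≤ (δ ^ 2) ^ 2 * (‖d‖ + δ) ^ 2 := by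
    rw [mul_comm ε]
    gcongr
  generalize hR' : (deriv w (γ 1) ^ 2 - w (γ 1) ^ 4 - 2 * w (γ 1) - γ 1 / α * w (γ 1) ^ 2) -
      (deriv w (γ 0) ^ 2 - w (γ 0) ^ 4 - 2 * w (γ 0) - γ 0 / α * w (γ 0) ^ 2) = R at hR
  have key : deriv w (γ 1) ^ 2 - 6 * d ^ 2 * (w (γ 1) - d) ^ 2
      = (4 * d * (w (γ 1) - d) ^ 3 + (w (γ 1) - d) ^ 4) + deriv w (γ 0) ^ 2
        - (6 * d ^ 2 * (w (γ 0) - d) ^ 2 + 4 * d * (w (γ 0) - d) ^ 3 + (w (γ 0) - d) ^ 4)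
        + (R + γ 1 / α * w (γ 1) ^ 2 - γ 0 / α * w (γ 0) ^ 2) := by
    rw [← hR']
    linear_combination (4 * w (γ 1) - 4 * w (γ 0)) * hd
  have e1 : ‖4 * d * (w (γ 1) - d) ^ 3 + (w (γ 1) - d) ^ 4‖ ≤ 4 * ‖d‖ * δ ^ 3 + δ ^ 4 := by
    refine (norm_add_le _ _).trans ?_
    simp only [norm_mul, norm_pow, Complex.norm_ofNat]
    gcongr
  have e2 : ‖deriv w (γ 0) ^ 2‖ ≤ (δ ^ 2) ^ 2 := by
    rw [norm_pow]
    gcongr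
  have e3 : ‖6 * d ^ 2 * (w (γ 0) - d) ^ 2 + 4 * d * (w (γ 0) - d) ^ 3 + (w (γ 0) - d) ^ 4‖
      ≤ 6 * ‖d‖ ^ 2 * δ ^ 2 + 4 * ‖d‖ * δ ^ 3 + δ ^ 4 := by
    refine norm_add₃_le.trans ?_
    simp only [norm_mul, norm_pow, Complex.norm_ofNat]
    gcongr
  have e4 : ‖R + γ 1 / α * w (γ 1) ^ 2 - γ 0 / α * w (γ 0) ^ 2‖
      ≤ (δ ^ 2) ^ 2 * (‖d‖ + δ) ^ 2 := by
    refine (norm_sub_le_of_le (norm_add_le_of_le (hR.trans hlen') hb1) hb0).trans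
      (le_of_eq_of_le ?_ hκR)
    rw [hκ]
    ring
  rw [key]
  exact (norm_add_le_of_le (norm_sub_le_of_le (norm_add_le_of_le e1 e2) e3) e4).trans
    (degenerate_error_le hδ0 (norm_nonneg d) hd1 hdlo hdsum)
end
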